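/- Consistency of the combined choice set in the Independence Lemma: let X be an R-equivalence class of L-maxiconsistent sets, for each a ∈ Ag let e_a be an ≃_a-equivalence class within X, let Γ_a be the set of sentences of the form [c]_aA shared by all members of e_a, and let Δ be the set of sentences of the form SA shared by all members of X; then the set Λ = (⋃_{a ∈ Ag} Γ_a) ∪ Δ is L-consistent. -/

import Mathlib

set_option maxHeartbeats 1000000

/-! Syntax: countably many variables (indexed by ℕ), Booleans (⊥, →),
    modalities `S` (box), `[c]_a` (cstit) and `I_a` (imag) for agents in `Agent`. -/

inductive Form (Agent : Type) : Type
  | var : ℕ → Form Agent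
  | fls : Form Agent
  | imp : Form Agent → Form Agent → Form Agent
  | box : Form Agent → Form Agent
  | cstit : Agent → Form Agent → Form Agent
  | imag : Agent → Form Agent → Form Agent

namespace Form

variable {Agent : Type}

def neg (A : Form Agent) : Form Agent := A.imp .fls

def conj (A B : Form Agent) : Form Agent := (A.imp B.neg).neg

def fiff (A B : Form Agent) : Form Agent := (A.imp B).conj (B.imp A)

/-- `P`, the dual of `S`. -/
def pos (A : Form Agent) : Form Agent := A.neg.box.neg

/-- The dual of `[c]_a`. -/
def posC (a : Agent) (A : Form Agent) : Form Agent := (Form.cstit a A.neg).neg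

def verum : Form Agent := (Form.fls : Form Agent).neg

end Form

def listConj {Agent : Type} : List (Form Agent) → Form Agent
  | [] => Form.verum
  | A :: l => A.conj (listConj l)

/-- Propositional tautologies: true under every Boolean valuation treating
    variables and modalized formulas as atoms. -/
def Tautology {Agent : Type} (A : Form Agent) : Prop :=
  ∀ v : Form Agent → Prop, ¬ v .fls → (∀ B C : Form Agent, v (B.imp C) ↔ (v B → v C)) → v A

/-- The Hilbert system L: (A0) tautologies, (A1) S is S5, (A2) each [c]_a is S5,
    (A3) SA → [c]_aA, (A4) independence axiom, (A5) imagination-as-action axiom;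
    rules: modus ponens, S-necessitation, replacement of equivalents under I_a. -/
inductive Prov {Agent : Type} : Form Agent → Prop
  | taut {A : Form Agent} : Tautology A → Prov A
  | sK (A B : Form Agent) : Prov ((A.imp B).box.imp (A.box.imp B.box))
  | sT (A : Form Agent) : Prov (A.box.imp A)
  | s5 (A : Form Agent) : Prov (A.pos.imp A.pos.box)
  | cK (a : Agent) (A B : Form Agent) :
      Prov ((Form.cstit a (A.imp B)).imp ((Form.cstit a A).imp (Form.cstit a B)))
  | cT (a : Agent) (A : Form Agent) : Prov ((Form.cstit a A).imp A)
  | c5 (a : Agent) (A : Form Agent) :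
      Prov ((Form.posC a A).imp (Form.cstit a (Form.posC a A)))
  | a3 (a : Agent) (A : Form Agent) : Prov (A.box.imp (Form.cstit a A))
  | a4 (l : List (Agent × Form Agent)) (hne : l ≠ []) (hnd : (l.map Prod.fst).Nodup) :
      Prov ((listConj (l.map fun p => (Form.cstit p.1 p.2).pos)).imp
        (listConj (l.map fun p => Form.cstit p.1 p.2)).pos)
  | a5 (a : Agent) (A : Form Agent) :
      Prov ((Form.imag a A).imp ((Form.cstit a (Form.imag a A)).conj (Form.imag a A).box.neg))
  | mp {A B : Form Agent} : Prov (A.imp B) → Prov A → Prov B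
  | necS {A : Form Agent} : Prov A → Prov A.box
  | reI (a : Agent) {A B : Form Agent} :
      Prov (A.fiff B) → Prov ((Form.imag a A).fiff (Form.imag a B))

/-- A set is L-consistent iff no finite conjunction of its members derives a contradiction. -/
def Consistent {Agent : Type} (Γ : Set (Form Agent)) : Prop :=
  ¬ ∃ l : List (Form Agent), (∀ A ∈ l, A ∈ Γ) ∧ Prov ((listConj l).imp .fls)

/-- L-maxiconsistent: L-consistent and maximal among L-consistent sets. -/
def MaxConsistent {Agent : Type} (w : Set (Form Agent)) : Prop :=
  Consistent w ∧ ∀ Γ : Set (Form Agent), Consistent Γ → w ⊆ Γ → Γ = w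

/-- Σ = {¬p : p ∈ Var} ∪ {SA ↔ A} ∪ {[c]_aA ↔ A}. -/
def SigmaSet (Agent : Type) : Set (Form Agent) :=
  {φ | (∃ n : ℕ, φ = (Form.var n : Form Agent).neg) ∨
       (∃ A : Form Agent, φ = A.box.fiff A) ∨
       (∃ (a : Agent) (A : Form Agent), φ = (Form.cstit a A).fiff A)}

/-! Semantics: imagination models and satisfaction. -/

/-- The raw data of an imagination model (frame conditions separated out below). -/
structure PreModel (Agent : Type) where
  Tree : Type
  le : Tree → Tree → Prop
  Choice : Tree → Agent → Set (Set (Set Tree))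
  N : Agent → Tree → Set Tree → Set (Set (Tree × Set Tree))
  V : ℕ → Set (Tree × Set Tree)

namespace PreModel

variable {Agent : Type} (M : PreModel Agent)

/-- Histories are maximal chains. -/
def IsHist (h : Set M.Tree) : Prop := IsMaxChain M.le h

/-- The set of histories passing through `m`. -/
def Hm (m : M.Tree) : Set (Set M.Tree) := {h | M.IsHist h ∧ m ∈ h}

/-- `Choice^m_a(h)`: the histories lying in the same choice cell as `h` at `m`. -/
def Cell (m : M.Tree) (a : Agent) (h : Set M.Tree) : Set (Set M.Tree) :=
  {h' | ∃ e ∈ M.Choice m a, h ∈ e ∧ h' ∈ e}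

/-- Satisfaction at a moment-history pair. -/
def Sat : Form Agent → M.Tree → Set M.Tree → Prop
  | .var n, m, h => (m, h) ∈ M.V n
  | .fls, _, _ => False
  | .imp A B, m, h => Sat A m h → Sat B m h
  | .box A, m, h => ∀ h' ∈ M.Hm m, Sat A m h'
  | .cstit a A, m, h => ∀ h' ∈ M.Cell m a h, Sat A m h'
  | .imag a A, m, h =>
      (∀ h' ∈ M.Cell m a h,
        {p : M.Tree × Set M.Tree | M.IsHist p.2 ∧ p.1 ∈ p.2 ∧ Sat A p.1 p.2} ∈ M.N a m h') ∧
      (∃ h'' ∈ M.Hm m,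
        {p : M.Tree × Set M.Tree | M.IsHist p.2 ∧ p.1 ∈ p.2 ∧ Sat A p.1 p.2} ∉ M.N a m h'')

end PreModel

/-- An imagination model: the raw data together with all frame conditions. -/
structure IModel (Agent : Type) extends PreModel Agent where
  tree_nonempty : Nonempty Tree
  le_refl : ∀ x, le x x
  le_antisymm : ∀ x y, le x y → le y x → x = y
  le_trans : ∀ x y z, le x y → le y z → le x z
  lower_bound : ∀ m1 m2, ∃ m, le m m1 ∧ le m m2
  past_linear : ∀ m m1 m2, le m1 m → le m2 m → le m1 m2 ∨ le m2 m1
  choice_cells_nonempty : ∀ m a, ∀ e ∈ Choice m a, e.Nonempty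
  choice_cover : ∀ m a, ⋃₀ (Choice m a) = toPreModel.Hm m
  choice_disjoint : ∀ m a, ∀ e ∈ Choice m a, ∀ e' ∈ Choice m a, e ≠ e' → e ∩ e' = ∅
  no_choice_between_undivided : ∀ m a, ∀ e ∈ Choice m a, ∀ h h',
      h ∈ toPreModel.Hm m → h' ∈ toPreModel.Hm m → h ∈ e →
      (∃ m', (le m m' ∧ m ≠ m') ∧ m' ∈ h ∧ m' ∈ h') → h' ∈ e
  independence : ∀ m (f : Agent → Set (Set Tree)), (∀ a, f a ∈ Choice m a) →
      (⋂ a, f a).Nonempty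

/-! The canonical model. -/

section Canonical

variable {Agent : Type}

/-- wRw' iff {A : SA ∈ w} ⊆ w'. -/
def CanR (w w' : Set (Form Agent)) : Prop := ∀ A : Form Agent, A.box ∈ w → A ∈ w'

/-- w ≃_a w' iff {A : [c]_aA ∈ w} ⊆ w'. -/
def CanC (a : Agent) (w w' : Set (Form Agent)) : Prop :=
  ∀ A : Form Agent, Form.cstit a A ∈ w → A ∈ w'

/-- The R-class of a maxiconsistent set. -/
def RCls (w : Set (Form Agent)) : Set (Set (Form Agent)) :=
  {w' | MaxConsistent w' ∧ CanR w w'}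

/-- Ξ: the set of R-equivalence classes. -/
def Xi (Agent : Type) : Set (Set (Set (Form Agent))) :=
  {X | ∃ w, MaxConsistent w ∧ X = RCls w}

/-- E(X,a): the ≃_a-equivalence classes within X. -/
def ECls (X : Set (Set (Form Agent))) (a : Agent) : Set (Set (Set (Form Agent))) :=
  {e | ∃ w ∈ X, e = {w' ∈ X | CanC a w w'}}

/-- Raw canonical points: the fresh root `none`, classes `some (inl X)`, worlds `some (inr w)`. -/
def CPoint (Agent : Type) : Type := Option (Set (Set (Form Agent)) ⊕ Set (Form Agent))

/-- Tree = {0} ∪ Ξ ∪ W. -/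
def CTreeSet (Agent : Type) : Set (CPoint Agent) :=
  {x | x = none ∨ (∃ X ∈ Xi Agent, x = some (Sum.inl X)) ∨
       (∃ w, MaxConsistent w ∧ x = some (Sum.inr w))}

def CTree (Agent : Type) : Type := {x : CPoint Agent // x ∈ CTreeSet Agent}

/-- x ≤ y iff x = y or y ∈ x or x = 0. -/
def CLe (x y : CTree Agent) : Prop :=
  x = y ∨ (∃ X w, x.1 = some (Sum.inl X) ∧ y.1 = some (Sum.inr w) ∧ w ∈ X) ∨ x.1 = none

/-- h_w = {0, X, w}. -/
def CHistX (X : Set (Set (Form Agent))) (w : Set (Form Agent)) : Set (CTree Agent) :=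
  {x | x.1 = none ∨ x.1 = some (Sum.inl X) ∨ x.1 = some (Sum.inr w)}

def IsClsMoment (m : CTree Agent) : Prop := ∃ X, m.1 = some (Sum.inl X)

/-- The canonical choice function: vacuous outside Ξ, induced by E(X,a) at X ∈ Ξ. -/
def CChoice (m : CTree Agent) (a : Agent) : Set (Set (Set (CTree Agent))) :=
  {H | (¬ IsClsMoment m ∧ H = {h | IsMaxChain CLe h ∧ m ∈ h}) ∨
       (∃ X, m.1 = some (Sum.inl X) ∧ ∃ e ∈ ECls X a,
          H = {h | ∃ w ∈ e, h = CHistX X w})}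

/-- Ext(A): {X/h_w : w ∈ X ∈ Ξ, A ∈ w}, augmented by all pairs m/h_w with m ∉ Ξ, m ∈ h_w,
    in case A belongs to the maxiconsistent extension of Σ. -/
def CExt (A : Form Agent) : Set (CTree Agent × Set (CTree Agent)) :=
  {p | ∃ X w, X ∈ Xi Agent ∧ w ∈ X ∧ A ∈ w ∧
        p.1.1 = some (Sum.inl X) ∧ p.2 = CHistX X w} ∪
  {p | (∃ w0, MaxConsistent w0 ∧ SigmaSet Agent ⊆ w0 ∧ A ∈ w0) ∧
        ∃ X w, X ∈ Xi Agent ∧ w ∈ X ∧ p.2 = CHistX X w ∧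
          ¬ IsClsMoment p.1 ∧ p.1 ∈ p.2}

/-- N_a(X/h_w) = {Ext A : I_aA ∈ w}; empty at moments outside Ξ. -/
def CN (a : Agent) (m : CTree Agent) (h : Set (CTree Agent)) :
    Set (Set (CTree Agent × Set (CTree Agent))) :=
  {P | ∃ X w, m.1 = some (Sum.inl X) ∧ X ∈ Xi Agent ∧ w ∈ X ∧ h = CHistX X w ∧
        ∃ A, Form.imag a A ∈ w ∧ P = CExt A}

/-- V(p) = {X/h_w : w ∈ X ∈ Ξ, p ∈ w}. -/
def CV (Agent : Type) (n : ℕ) : Set (CTree Agent × Set (CTree Agent)) :=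
  {p | ∃ X w, X ∈ Xi Agent ∧ w ∈ X ∧ Form.var n ∈ w ∧
        p.1.1 = some (Sum.inl X) ∧ p.2 = CHistX X w}

/-- The canonical model (raw data). -/
def CanModel (Agent : Type) : PreModel Agent where
  Tree := CTree Agent
  le := CLe
  Choice := CChoice
  N := CN
  V := CV Agent

/-- The canonical moment corresponding to a class X ∈ Ξ. -/
def clsMoment {X : Set (Set (Form Agent))} (hX : X ∈ Xi Agent) : CTree Agent :=
  ⟨some (Sum.inl X), Or.inr (Or.inl ⟨X, hX, rfl⟩)⟩

end Canonical
section Helpers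

variable {Agent : Type}

def IsVal (v : Form Agent → Prop) : Prop :=
  ¬ v .fls ∧ ∀ B C : Form Agent, v (B.imp C) ↔ (v B → v C)

theorem IsVal.hneg {v : Form Agent → Prop} (h : IsVal v) (A : Form Agent) :
    v A.neg ↔ ¬ v A := by
  have h1 := h.1
  have h2 := h.2 A .fls
  unfold Form.neg
  tauto

theorem IsVal.hconj {v : Form Agent → Prop} (h : IsVal v) (A B : Form Agent) :
    v (A.conj B) ↔ (v A ∧ v B) := by
  unfold Form.conj
  rw [h.hneg, h.2, h.hneg]
  tauto

theorem IsVal.hlist {v : Form Agent → Prop} (h : IsVal v) (l : List (Form Agent)) :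
    v (listConj l) ↔ ∀ A ∈ l, v A := by
  induction l with
  | nil =>
    simp only [listConj, Form.verum, h.hneg]
    simpa using h.1
  | cons A l ih => simp [listConj, h.hconj, ih]

theorem prov0 {C : Form Agent} (h : ∀ v, IsVal v → v C) : Prov C :=
  Prov.taut fun v h1 h2 => h v ⟨h1, h2⟩

theorem prov1 {A C : Form Agent} (hA : Prov A) (h : ∀ v, IsVal v → v A → v C) : Prov C :=
  Prov.mp (prov0 fun v hv => (hv.2 _ _).2 (h v hv)) hA

theorem prov2 {A B C : Form Agent} (hA : Prov A) (hB : Prov B)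
    (h : ∀ v, IsVal v → v A → v B → v C) : Prov C :=
  Prov.mp (prov1 hA fun v hv ha => (hv.2 _ _).2 (h v hv ha)) hB

theorem prov_listConj {D : Form Agent} (l : List (Form Agent))
    (h : ∀ A ∈ l, Prov (D.imp A)) : Prov (D.imp (listConj l)) := by
  induction l with
  | nil =>
    refine prov0 fun v hv => ?_
    rw [hv.2, hv.hlist]
    simp
  | cons A l ih =>
    refine prov2 (h A (by simp)) (ih fun B hB => h B (by simp [hB])) fun v hv h1 h2 => ?_
    rw [hv.2] at *
    simp only [listConj, hv.hconj]
    tauto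

theorem mcs_not {w : Set (Form Agent)} (hw : MaxConsistent w) {A : Form Agent} (hA : A ∉ w) :
    ∃ m : List (Form Agent), (∀ B ∈ m, B ∈ w) ∧ Prov ((listConj m).imp A.neg) := by
  classical
  by_contra hcon
  apply hA
  have : insert A w = w := by
    refine hw.2 _ ?_ (Set.subset_insert _ _)
    rintro ⟨l, hl, hp⟩
    refine hcon ⟨l.filter (fun B => B ≠ A), ?_, ?_⟩
    · intro B hB
      rw [List.mem_filter] at hB
      rcases hl B hB.1 with h | h
      · simp [h] at hB
      · exact h
    · refine prov1 hp fun v hv h => ?_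
      rw [hv.2, hv.hlist] at *
      rw [hv.hneg]
      intro h1 h2
      refine hv.1 (h fun B hB => ?_)
      by_cases hBA : B = A
      · exact hBA ▸ h2
      · exact h1 B (by simp [List.mem_filter, hB, hBA])
  rw [← this]
  exact Set.mem_insert _ _

theorem mcs_closed {w : Set (Form Agent)} (hw : MaxConsistent w) {B : Form Agent}
    (m : List (Form Agent)) (hm : ∀ A ∈ m, A ∈ w) (hp : Prov ((listConj m).imp B)) : B ∈ w := by
  by_contra hB
  obtain ⟨m', hm', hp'⟩ := mcs_not hw hB
  refine hw.1 ⟨m ++ m', ?_, ?_⟩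
  · intro A hA
    rcases List.mem_append.1 hA with h | h
    · exact hm A h
    · exact hm' A h
  · refine prov2 hp hp' fun v hv h1 h2 => ?_
    rw [hv.2, hv.hlist] at *
    rw [hv.hneg] at h2
    intro h
    exact absurd (h1 fun A hA => h A (by simp [hA])) (h2 fun A hA => h A (by simp [hA]))

theorem mcs_thm {w : Set (Form Agent)} (hw : MaxConsistent w) {B : Form Agent}
    (h : Prov B) : B ∈ w :=
  mcs_closed hw [] (by simp) (prov1 h fun v hv hB => (hv.2 _ _).2 fun _ => hB)

theorem mcs_mp {w : Set (Form Agent)} (hw : MaxConsistent w) {A B : Form Agent}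
    (h : A.imp B ∈ w) (hA : A ∈ w) : B ∈ w := by
  refine mcs_closed hw [A.imp B, A] (by simp [h, hA]) (prov0 fun v hv => ?_)
  rw [hv.2, hv.hlist]
  intro h
  exact (hv.2 _ _).1 (h (A.imp B) (by simp)) (h A (by simp))

theorem mcs_neg {w : Set (Form Agent)} (hw : MaxConsistent w) {A : Form Agent} :
    A.neg ∈ w ↔ A ∉ w := by
  constructor
  · intro h hA
    refine hw.1 ⟨[.fls], ?_, ?_⟩
    · simpa using mcs_mp hw h hA
    · refine prov0 fun v hv => ?_
      rw [hv.2, hv.hlist]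
      intro h
      exact h _ (by simp)
  · intro h
    obtain ⟨m, hm, hp⟩ := mcs_not hw h
    exact mcs_closed hw m hm hp

theorem box_mono {A B : Form Agent} (h : Prov (A.imp B)) : Prov (A.box.imp B.box) :=
  Prov.mp (Prov.sK _ _) (Prov.necS h)

theorem cnec (a : Agent) {A : Form Agent} (h : Prov A) : Prov (Form.cstit a A) :=
  Prov.mp (Prov.a3 a A) (Prov.necS h)

theorem c_mono (a : Agent) {A B : Form Agent} (h : Prov (A.imp B)) :
    Prov ((Form.cstit a A).imp (Form.cstit a B)) :=
  Prov.mp (Prov.cK _ _ _) (cnec a h)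

theorem mod_list {w : Set (Form Agent)} (hw : MaxConsistent w) (M : Form Agent → Form Agent)
    (hK : ∀ A B, Prov ((M (A.imp B)).imp ((M A).imp (M B))))
    (hN : ∀ A, Prov A → Prov (M A)) (l : List (Form Agent)) :
    ∀ C, (∀ A ∈ l, M A ∈ w) → Prov ((listConj l).imp C) → M C ∈ w := by
  induction l with
  | nil =>
    intro C _ hp
    refine mcs_thm hw (hN _ (prov1 hp fun v hv h => ?_))
    rw [hv.2, hv.hlist] at h
    exact h (by simp)
  | cons A l ih =>
    intro C hl hp
    have h1 : M (A.imp C) ∈ w := by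
      refine ih _ (fun B hB => hl B (by simp [hB])) (prov1 hp fun v hv h => ?_)
      simp only [listConj, hv.2, hv.hconj] at *
      tauto
    exact mcs_mp hw (mcs_mp hw (mcs_thm hw (hK _ _)) h1) (hl A (by simp))

theorem pos_box (D : Form Agent) : Prov (D.box.pos.imp D.box) := by
  have h1 : Prov (D.neg.neg.box.imp D.box) := box_mono (prov0 fun v hv => by
    rw [hv.2, hv.hneg, hv.hneg]; tauto)
  have h2 : Prov (D.box.imp D.neg.neg.box) := box_mono (prov0 fun v hv => by
    rw [hv.2, hv.hneg, hv.hneg]; tauto)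
  have h3 : Prov (D.neg.neg.box.neg.box.imp D.box.neg.box) := box_mono (prov1 h2 fun v hv h => by
    rw [hv.2] at *
    rw [hv.hneg, hv.hneg]
    tauto)
  have h4 := Prov.s5 D.neg
  unfold Form.pos at *
  refine prov2 (prov2 h1 h3 (C := (D.neg.neg.box.imp D.box).conj
    (D.neg.neg.box.neg.box.imp D.box.neg.box)) fun v hv a b => (hv.hconj _ _).2 ⟨a, b⟩) h4
    fun v hv a b => ?_
  simp only [hv.hconj, hv.2 _ D.box, hv.2 _ D.box.neg.box, hv.2 D.neg.neg.box.neg, hv.hneg] at *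
  tauto

theorem box_pos {w : Set (Form Agent)} (hw : MaxConsistent w) {D : Form Agent}
    (h : D.box ∈ w) : D.box.box ∈ w := by
  have h1 : D.box.pos ∈ w := by
    unfold Form.pos
    rw [mcs_neg hw]
    intro h2
    exact (mcs_neg hw).1 (mcs_mp hw (mcs_thm hw (Prov.sT _)) h2) h
  exact mcs_mp hw (mcs_thm hw (box_mono (pos_box D))) (mcs_mp hw (mcs_thm hw (Prov.s5 _)) h1)

end Helpers

/-- consistency of the combined choice set Λ = (⋃_a Γ_a) ∪ Δ in the
    Independence Lemma, where Γ_a collects the [c]_a-formulas shared by all members of a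
    chosen ≃_a-class e_a within X, and Δ the S-formulas shared by all members of X. -/
theorem combined_choice_set_consistent (Agent : Type) [Fintype Agent]
    (X : Set (Set (Form Agent))) (hX : X ∈ Xi Agent)
    (e : Agent → Set (Set (Form Agent))) (he : ∀ a, e a ∈ ECls X a) :
    Consistent
      ((⋃ a : Agent, {φ : Form Agent | (∃ A : Form Agent, φ = Form.cstit a A) ∧ ∀ w ∈ e a, φ ∈ w}) ∪
        {φ : Form Agent | (∃ A : Form Agent, φ = Form.box A) ∧ ∀ w ∈ X, φ ∈ w}) := by
  classical
  obtain ⟨w0, hw0, rfl⟩ := hX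
  have hw0X : w0 ∈ RCls w0 := ⟨hw0, fun A hA => mcs_mp hw0 (mcs_thm hw0 (Prov.sT _)) hA⟩
  choose w hwX hwe using he
  have hwm : ∀ a, MaxConsistent (w a) := fun a => (hwX a).1
  have hwin : ∀ a, w a ∈ e a := fun a => by
    rw [hwe a]
    exact ⟨hwX a, fun A hA => mcs_mp (hwm a) (mcs_thm (hwm a) (Prov.cT _ _)) hA⟩
  rintro ⟨l, hl, hp⟩
  have hl' : ∀ φ ∈ l, (∃ a A, φ = Form.cstit a A ∧ φ ∈ w a) ∨ (∃ A, φ = Form.box A ∧ φ ∈ w0) := by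
    intro φ hφ
    rcases hl φ hφ with h | h
    · obtain ⟨a, ⟨A, hA⟩, h⟩ := Set.mem_iUnion.1 h
      exact Or.inl ⟨a, A, hA, h _ (hwin a)⟩
    · obtain ⟨⟨A, hA⟩, h⟩ := h
      exact Or.inr ⟨A, hA, h _ hw0X⟩
  let bl := l.filter (fun φ => ∃ A, φ = Form.box A ∧ φ ∈ w0)
  have hbl : ∀ φ ∈ bl, φ.box ∈ w0 := by
    intro φ hφ
    have := (List.mem_filter.1 hφ).2
    simp only [decide_eq_true_eq] at this
    obtain ⟨A, rfl, h⟩ := this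
    exact box_pos hw0 h
  let strip : Agent → Form Agent → List (Form Agent) := fun a φ =>
    match φ with
    | .cstit b A => if b = a ∧ Form.cstit a A ∈ w a then [A] else []
    | _ => []
  have hstrip : ∀ a φ A, A ∈ strip a φ → Form.cstit a A ∈ w a := by
    intro a φ A h
    cases φ <;> simp [strip] at h
    obtain ⟨⟨rfl, h⟩, rfl⟩ := h
    exact h
  let B : Agent → Form Agent := fun a => listConj (l.flatMap (strip a))
  have hB : ∀ a, Form.cstit a (B a) ∈ w a := by
    intro a
    refine mod_list (hwm a) (Form.cstit a) (Prov.cK a) (fun A => cnec a) _ _ ?_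
      (prov0 fun v hv => (hv.2 _ _).2 id)
    intro A hA
    obtain ⟨φ, _, h⟩ := List.mem_flatMap.1 hA
    exact hstrip a φ A h
  have hBA : ∀ a A, Form.cstit a A ∈ l → Form.cstit a A ∈ w a →
      Prov ((Form.cstit a (B a)).imp (Form.cstit a A)) := by
    intro a A h1 h2
    refine c_mono a (prov0 fun v hv => ?_)
    rw [hv.2, hv.hlist]
    intro h
    exact h A (List.mem_flatMap.2 ⟨_, h1, by simp [strip, h2]⟩)
  have hPB : ∀ a, (Form.cstit a (B a)).pos ∈ w0 := by
    intro a
    unfold Form.pos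
    rw [mcs_neg hw0]
    intro h
    exact (mcs_neg (hwm a)).1 ((hwX a).2 _ h) (hB a)
  let L : List (Agent × Form Agent) := (Finset.univ : Finset Agent).toList.map fun a => (a, B a)
  let K := listConj (L.map fun p => Form.cstit p.1 p.2)
  have hmain : Prov ((listConj bl).imp K.neg) := by
    have h1 : Prov (((listConj bl).conj K).imp (listConj l)) := by
      refine prov_listConj l fun φ hφ => ?_
      rcases hl' φ hφ with ⟨a, A, rfl, h⟩ | h
      · refine prov1 (hBA a A hφ h) fun v hv h2 => ?_
        rw [hv.2] at *
        rw [hv.hconj, hv.hlist (L.map fun p => Form.cstit p.1 p.2)]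
        intro h3
        refine h2 (h3.2 _ ?_)
        simp only [L, List.map_map, List.mem_map]
        exact ⟨a, by simp, rfl⟩
      · refine prov0 fun v hv => ?_
        rw [hv.2, hv.hconj, hv.hlist]
        exact fun h3 => h3.1 φ (List.mem_filter.2 ⟨hφ, by simpa using h⟩)
    refine prov2 h1 hp fun v hv a b => ?_
    rw [hv.2] at *
    rw [hv.hconj] at a
    rw [hv.hneg]
    exact fun x y => hv.1 (b (a ⟨x, y⟩))
  have hbox : K.neg.box ∈ w0 :=
    mod_list hw0 Form.box Prov.sK (fun A => Prov.necS) bl _ hbl hmain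
  by_cases hne : L = []
  · refine (mcs_neg hw0).1 (mcs_mp hw0 (mcs_thm hw0 (Prov.sT _)) hbox) (mcs_thm hw0 ?_)
    refine prov0 fun v hv => ?_
    simp only [K, hne, hv.hlist]
    simp
  · have hnd : (L.map Prod.fst).Nodup := by
      simp only [L, List.map_map]
      have : (Prod.fst ∘ fun a => (a, B a)) = id := rfl
      rw [this, List.map_id]
      exact Finset.nodup_toList _
    have h4 : K.pos ∈ w0 := by
      refine mcs_closed hw0 _ ?_ (Prov.a4 L hne hnd)
      intro φ hφ
      simp only [L, List.map_map, List.mem_map] at hφ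
      obtain ⟨a, _, rfl⟩ := hφ
      exact hPB a
    exact (mcs_neg hw0).1 h4 hbox
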